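/- Let m≥1 and β=(β_1,…,β_m)∈(−1,∞)^m, and write β=β_1+…+β_m for the sum of the parameters. There exist constants 0<c≤C depending only on m and the parameters such that for every v∈S_+^{m−1} with all coordinates v_i>0 and every s∈(s_1(v),‖v‖_1), where s_1(v)=‖v‖_1−2 min_i v_i, one has c·(‖v‖_1−s)^{β+m}·∏_{i=1}^m v_i^{−β_i−1} ≤ P_m(C^+(v,s);β) ≤ C·(‖v‖_1−s)^{β+m}·∏_{i=1}^m v_i^{−β_i−1}. -/

import Mathlib

open MeasureTheory Filter
open scoped RealInnerProductSpace

noncomputable section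

/-- Normalizing constant `c_β = c_{β,1}` of the one-dimensional beta density on `[−1,1]`. -/
def betaConst1 (β : ℝ) : ℝ :=
  Real.Gamma (3 / 2 + β) / (Real.pi ^ ((1 : ℝ) / 2) * Real.Gamma (β + 1))

/-- The `β`-content `P_m(A;β) = ∫_A ∏_i c_{β_i}(1−y_i²)^{β_i} dy` of a set
`A ⊆ [−1,1]^m`. -/
def betaContent {m : ℕ} (β : Fin m → ℝ) (A : Set (EuclideanSpace ℝ (Fin m))) : ℝ :=
  ∫ y in A, ∏ i, betaConst1 (β i) * (1 - y i ^ 2) ^ (β i)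

/-- The meta-cap `C^+(v,s) = [−1,1]^m ∩ H^+(v,s)`. -/
def metaCap {m : ℕ} (v : EuclideanSpace ℝ (Fin m)) (s : ℝ) :
    Set (EuclideanSpace ℝ (Fin m)) :=
  {y | (∀ i, |y i| ≤ 1) ∧ s ≤ ⟪y, v⟫}

theorem betaConst1_pos {β : ℝ} (hβ : -1 < β) : 0 < betaConst1 β := by
  unfold betaConst1
  have h1 : 0 < Real.Gamma (3 / 2 + β) := Real.Gamma_pos_of_pos (by linarith)
  have h2 : 0 < Real.Gamma (β + 1) := Real.Gamma_pos_of_pos (by linarith)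
  positivity

/-- A power with base in `[1, 2]` is bounded between the values at the endpoints. -/
theorem rpow_mem_Icc_of_mem_Icc_one_two {x : ℝ} (β : ℝ) (h1 : 1 ≤ x) (h2 : x ≤ 2) :
    min 1 ((2 : ℝ) ^ β) ≤ x ^ β ∧ x ^ β ≤ max 1 ((2 : ℝ) ^ β) := by
  rcases le_total 0 β with hb | hb
  · exact ⟨(min_le_left _ _).trans (Real.one_le_rpow h1 hb),
      (Real.rpow_le_rpow (by linarith) h2 hb).trans (le_max_right _ _)⟩
  · exact ⟨(min_le_right _ _).trans (Real.rpow_le_rpow_of_nonpos (by linarith) h2 hb),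
      (Real.rpow_le_one_of_one_le_of_nonpos h1 hb).trans (le_max_left _ _)⟩

theorem one_sub_sq_rpow_eq_mul {y : ℝ} (β : ℝ) (h0 : -1 ≤ y) (h1 : y ≤ 1) :
    (1 - y ^ 2) ^ β = (1 - y) ^ β * (1 + y) ^ β := by
  rw [← Real.mul_rpow (by linarith) (by linarith)]
  ring_nf

theorem one_sub_sq_rpow_nonneg {y : ℝ} (β : ℝ) (h0 : -1 ≤ y) (h1 : y ≤ 1) :
    0 ≤ (1 - y ^ 2) ^ β :=
  Real.rpow_nonneg (by nlinarith) _

theorem integrableOn_one_sub_rpow {β : ℝ} (hβ : -1 < β) {a : ℝ} (ha : 0 ≤ a) :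
    IntegrableOn (fun y : ℝ => (1 - y) ^ β) (Set.Icc (1 - a) 1) := by
  have h := (intervalIntegral.intervalIntegrable_rpow' (a := a) (b := 0) hβ).comp_sub_left 1
  rw [sub_zero, intervalIntegrable_iff_integrableOn_Icc_of_le (by linarith)] at h
  exact h

theorem setIntegral_one_sub_rpow {β : ℝ} (hβ : -1 < β) {a : ℝ} (ha : 0 ≤ a) :
    ∫ y in Set.Icc (1 - a) 1, (1 - y) ^ β = a ^ (β + 1) / (β + 1) := by
  rw [integral_Icc_eq_integral_Ioc, ← intervalIntegral.integral_of_le (by linarith),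
    intervalIntegral.integral_comp_sub_left (fun x => x ^ β) 1, sub_self, sub_sub_cancel,
    integral_rpow (Or.inl hβ), Real.zero_rpow (by linarith), sub_zero]

theorem measurable_one_sub_sq_rpow (β : ℝ) : Measurable fun y : ℝ => (1 - y ^ 2) ^ β := by
  fun_prop

theorem integrableOn_one_sub_sq_rpow {β : ℝ} (hβ : -1 < β) :
    IntegrableOn (fun y : ℝ => (1 - y ^ 2) ^ β) (Set.Icc (-1) 1) := by
  have h01 : IntegrableOn (fun y : ℝ => (1 - y ^ 2) ^ β) (Set.Icc 0 1) := by
    have h := (integrableOn_one_sub_rpow hβ zero_le_one).const_mul (max 1 ((2 : ℝ) ^ β))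
    rw [sub_self] at h
    refine Integrable.mono' h (measurable_one_sub_sq_rpow β).aestronglyMeasurable ?_
    filter_upwards [ae_restrict_mem measurableSet_Icc] with y ⟨hy0, hy1⟩
    rw [Real.norm_of_nonneg (one_sub_sq_rpow_nonneg β (by linarith) hy1),
      one_sub_sq_rpow_eq_mul β (by linarith) hy1, mul_comm]
    exact mul_le_mul_of_nonneg_right
      (rpow_mem_Icc_of_mem_Icc_one_two β (by linarith) (by linarith)).2
      (Real.rpow_nonneg (by linarith) _)
  rw [← intervalIntegrable_iff_integrableOn_Icc_of_le zero_le_one] at h01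
  rw [← intervalIntegrable_iff_integrableOn_Icc_of_le (by norm_num)]
  have h10 := h01.comp_sub_left 0
  simp only [sub_zero, zero_sub, even_two, Even.neg_pow] at h10
  exact h10.symm.trans h01

/-- The mass that the unnormalized one-dimensional beta density puts on `[1 - a, 1]` is comparable
to `a ^ (β + 1)`. -/
theorem exists_setIntegral_one_sub_sq_rpow_bounds {β : ℝ} (hβ : -1 < β) :
    ∃ k K : ℝ, 0 < k ∧ 0 < K ∧ ∀ a : ℝ, 0 < a → a ≤ 2 →
      k * a ^ (β + 1) ≤ ∫ y in Set.Icc (1 - a) 1, (1 - y ^ 2) ^ β ∧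
        ∫ y in Set.Icc (1 - a) 1, (1 - y ^ 2) ^ β ≤ K * a ^ (β + 1) := by
  have hβ' : 0 < β + 1 := by linarith
  set l := min 1 ((2 : ℝ) ^ β) with hl
  set u := max 1 ((2 : ℝ) ^ β) with hu
  have hl0 : 0 < l := by positivity
  have hu0 : 0 < u := by positivity
  set T := ∫ y in Set.Icc (-1 : ℝ) 1, (1 - y ^ 2) ^ β with hT
  have hT0 : 0 ≤ T := setIntegral_nonneg measurableSet_Icc
    fun y hy => one_sub_sq_rpow_nonneg β hy.1 hy.2
  have hInt : ∀ a : ℝ, a ≤ 2 →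
      IntegrableOn (fun y : ℝ => (1 - y ^ 2) ^ β) (Set.Icc (1 - a) 1) := fun a ha =>
    (integrableOn_one_sub_sq_rpow hβ).mono_set (Set.Icc_subset_Icc_left (by linarith))
  have hmono : ∀ a b : ℝ, a ≤ b → b ≤ 2 → ∫ y in Set.Icc (1 - a) 1, (1 - y ^ 2) ^ β ≤
      ∫ y in Set.Icc (1 - b) 1, (1 - y ^ 2) ^ β := by
    intro a b hab hb
    refine setIntegral_mono_set (hInt b hb) ?_
      (Set.Icc_subset_Icc_left (by linarith)).eventuallyLE
    filter_upwards [ae_restrict_mem measurableSet_Icc] with y hy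
    exact one_sub_sq_rpow_nonneg β (by linarith [hy.1]) hy.2
  refine ⟨l / (β + 1) * (1 / 2) ^ (β + 1), u / (β + 1) + T, by positivity, by positivity,
    fun a ha0 ha2 => ⟨?_, ?_⟩⟩
  · refine le_trans ?_ (hmono (a / 2) a (by linarith) ha2)
    calc l / (β + 1) * (1 / 2) ^ (β + 1) * a ^ (β + 1)
        = l * ((a / 2) ^ (β + 1) / (β + 1)) := by
          rw [show a / 2 = 1 / 2 * a by ring, Real.mul_rpow (by norm_num) ha0.le]
          ring
      _ = ∫ y in Set.Icc (1 - a / 2) 1, l * (1 - y) ^ β := by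
          rw [integral_const_mul, setIntegral_one_sub_rpow hβ (by linarith)]
      _ ≤ _ := by
          refine setIntegral_mono_on ((integrableOn_one_sub_rpow hβ (by linarith)).const_mul l)
            (hInt _ (by linarith)) measurableSet_Icc fun y hy => ?_
          rw [one_sub_sq_rpow_eq_mul β (by linarith [hy.1]) hy.2, mul_comm]
          exact mul_le_mul_of_nonneg_left
            (rpow_mem_Icc_of_mem_Icc_one_two β (by linarith [hy.1]) (by linarith [hy.2])).1
            (Real.rpow_nonneg (by linarith [hy.2]) _)
  · rcases le_total a 1 with h1 | h1
    · calc ∫ y in Set.Icc (1 - a) 1, (1 - y ^ 2) ^ β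
          ≤ ∫ y in Set.Icc (1 - a) 1, u * (1 - y) ^ β := by
            refine setIntegral_mono_on (hInt _ ha2)
              ((integrableOn_one_sub_rpow hβ ha0.le).const_mul u) measurableSet_Icc fun y hy => ?_
            rw [one_sub_sq_rpow_eq_mul β (by linarith [hy.1]) hy.2, mul_comm]
            exact mul_le_mul_of_nonneg_right
              (rpow_mem_Icc_of_mem_Icc_one_two β (by linarith [hy.1]) (by linarith [hy.2])).2
              (Real.rpow_nonneg (by linarith [hy.2]) _)
        _ = u / (β + 1) * a ^ (β + 1) := by
            rw [integral_const_mul, setIntegral_one_sub_rpow hβ ha0.le]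
            ring
        _ ≤ _ := by
            gcongr
            linarith
    · have h2 : ∫ y in Set.Icc (1 - a) 1, (1 - y ^ 2) ^ β ≤ T := by
        have := hmono a 2 ha2 le_rfl
        rwa [show (1 : ℝ) - 2 = -1 by norm_num] at this
      have h3 : 1 ≤ a ^ (β + 1) := Real.one_le_rpow h1 hβ'.le
      have h4 : 0 < u / (β + 1) := by positivity
      nlinarith

/-- The product box `∏ i, [1 - a i, 1]`. -/
def vertexBox {m : ℕ} (a : Fin m → ℝ) : Set (EuclideanSpace ℝ (Fin m)) :=
  {y | ∀ i, y i ∈ Set.Icc (1 - a i) 1}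

theorem vertexBox_eq_preimage {m : ℕ} (a : Fin m → ℝ) :
    vertexBox a = (WithLp.ofLp : EuclideanSpace ℝ (Fin m) → Fin m → ℝ) ⁻¹'
      Set.univ.pi fun i => Set.Icc (1 - a i) 1 := by
  ext y
  simp only [vertexBox, Set.mem_ofPred_eq, Set.mem_preimage, Set.mem_univ_pi]

theorem measurableSet_vertexBox {m : ℕ} (a : Fin m → ℝ) : MeasurableSet (vertexBox a) := by
  rw [vertexBox_eq_preimage]
  exact (PiLp.volume_preserving_ofLp (Fin m)).measurable
    (MeasurableSet.univ_pi fun i => measurableSet_Icc)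

theorem betaContent_vertexBox {m : ℕ} (β a : Fin m → ℝ) :
    betaContent β (vertexBox a) =
      ∏ i, betaConst1 (β i) * ∫ y in Set.Icc (1 - a i) 1, (1 - y ^ 2) ^ β i := by
  unfold betaContent
  rw [vertexBox_eq_preimage, (PiLp.volume_preserving_ofLp (Fin m)).setIntegral_preimage_emb
    (MeasurableEquiv.toLp 2 (Fin m → ℝ)).symm.measurableEmbedding
    (fun y => ∏ i, betaConst1 (β i) * (1 - y i ^ 2) ^ (β i)), volume_pi,
    Measure.restrict_pi_pi, integral_fintype_prod_eq_prod
      (f := fun i y => betaConst1 (β i) * (1 - y ^ 2) ^ (β i))]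
  simp only [integral_const_mul]

theorem integrableOn_vertexBox {m : ℕ} {β a : Fin m → ℝ} (hβ : ∀ i, -1 < β i)
    (ha : ∀ i, a i ≤ 2) :
    IntegrableOn (fun y : EuclideanSpace ℝ (Fin m) =>
      ∏ i, betaConst1 (β i) * (1 - y i ^ 2) ^ (β i)) (vertexBox a) := by
  rw [vertexBox_eq_preimage]
  refine ((PiLp.volume_preserving_ofLp (Fin m)).integrableOn_comp_preimage
    (MeasurableEquiv.toLp 2 (Fin m → ℝ)).symm.measurableEmbedding
    (f := fun y => ∏ i, betaConst1 (β i) * (1 - y i ^ 2) ^ (β i))).2 ?_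
  rw [IntegrableOn, volume_pi, Measure.restrict_pi_pi]
  exact Integrable.fintype_prod (f := fun i y => betaConst1 (β i) * (1 - y ^ 2) ^ (β i))
    fun i => ((integrableOn_one_sub_sq_rpow (hβ i)).mono_set
      (Set.Icc_subset_Icc_left (by linarith [ha i]))).const_mul _

theorem prod_betaDensity_nonneg {m : ℕ} {β : Fin m → ℝ} (hβ : ∀ i, -1 < β i)
    {y : EuclideanSpace ℝ (Fin m)} (hy : ∀ i, |y i| ≤ 1) :
    0 ≤ ∏ i, betaConst1 (β i) * (1 - y i ^ 2) ^ (β i) :=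
  Finset.prod_nonneg fun i _ => mul_nonneg (betaConst1_pos (hβ i)).le
    (one_sub_sq_rpow_nonneg _ (abs_le.1 (hy i)).1 (abs_le.1 (hy i)).2)

theorem measurableSet_metaCap {m : ℕ} (v : EuclideanSpace ℝ (Fin m)) (s : ℝ) :
    MeasurableSet (metaCap v s) := by
  have h : IsClosed (metaCap v s) := by
    refine IsClosed.inter (s₁ := {y : EuclideanSpace ℝ (Fin m) | ∀ i, |y i| ≤ 1})
      (s₂ := {y | s ≤ ⟪y, v⟫}) ?_ (isClosed_le (by fun_prop) (by fun_prop))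
    rw [Set.ofPred_forall]
    exact isClosed_iInter fun i => isClosed_le (by fun_prop) (by fun_prop)
  exact h.measurableSet

theorem betaContent_mono {m : ℕ} {β : Fin m → ℝ} (hβ : ∀ i, -1 < β i)
    {A B : Set (EuclideanSpace ℝ (Fin m))} (hAB : A ⊆ B) (hB : MeasurableSet B)
    (hB1 : ∀ y ∈ B, ∀ i, |y i| ≤ 1) : betaContent β A ≤ betaContent β B := by
  have hsub : B ⊆ vertexBox fun _ => 2 := fun y hy i => by
    have := abs_le.1 (hB1 y hy i)
    exact ⟨by linarith, this.2⟩
  refine setIntegral_mono_set ((integrableOn_vertexBox hβ fun _ => le_rfl).mono_set hsub) ?_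
    hAB.eventuallyLE
  filter_upwards [ae_restrict_mem hB] with y hy using prod_betaDensity_nonneg hβ (hB1 y hy)

theorem abs_le_one_of_mem_vertexBox {m : ℕ} {a : Fin m → ℝ} (ha : ∀ i, a i ≤ 2)
    {y : EuclideanSpace ℝ (Fin m)} (hy : y ∈ vertexBox a) (i : Fin m) : |y i| ≤ 1 :=
  abs_le.2 ⟨by linarith [(hy i).1, ha i], (hy i).2⟩

theorem inner_eq_sum_sub_sum {m : ℕ} (y v : EuclideanSpace ℝ (Fin m)) :
    ⟪y, v⟫ = ∑ i, v i - ∑ i, v i * (1 - y i) := by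
  simp only [PiLp.inner_apply, RCLike.inner_apply, conj_trivial, ← Finset.sum_sub_distrib]
  exact Finset.sum_congr rfl fun i _ => by ring

theorem metaCap_subset_vertexBox {m : ℕ} {v : EuclideanSpace ℝ (Fin m)} (hv : ∀ i, 0 < v i)
    (s : ℝ) : metaCap v s ⊆ vertexBox fun i => (∑ j, v j - s) / v i := by
  rintro y ⟨hy, hs⟩ i
  refine ⟨?_, (abs_le.1 (hy i)).2⟩
  rw [inner_eq_sum_sub_sum] at hs
  have h1 : v i * (1 - y i) ≤ ∑ j, v j * (1 - y j) :=
    Finset.single_le_sum (f := fun j => v j * (1 - y j))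
      (fun j _ => mul_nonneg (hv j).le (by linarith [(abs_le.1 (hy j)).2])) (Finset.mem_univ i)
  have h2 : 1 - y i ≤ (∑ j, v j - s) / v i := by
    rw [le_div_iff₀ (hv i)]
    linarith
  linarith

theorem vertexBox_subset_metaCap {m : ℕ} (hm : 1 ≤ m) {v : EuclideanSpace ℝ (Fin m)}
    (hv : ∀ i, 0 < v i) {s : ℝ} (h2 : ∀ i, (∑ j, v j - s) / v i / m ≤ 2) :
    vertexBox (fun i => (∑ j, v j - s) / v i / m) ⊆ metaCap v s := by
  intro y hy
  refine ⟨abs_le_one_of_mem_vertexBox h2 hy, ?_⟩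
  rw [inner_eq_sum_sub_sum]
  have hm0 : (m : ℝ) ≠ 0 := by positivity
  have h : ∑ i, v i * (1 - y i) ≤ ∑ _i : Fin m, (∑ j, v j - s) / m := by
    refine Finset.sum_le_sum fun i _ => ?_
    have hv0 := (hv i).ne'
    calc v i * (1 - y i) ≤ v i * ((∑ j, v j - s) / v i / m) :=
          mul_le_mul_of_nonneg_left (by linarith [(hy i).1]) (hv i).le
      _ = _ := by field_simp
  rw [Finset.sum_const, Finset.card_univ, Fintype.card_fin, nsmul_eq_mul,
    mul_div_cancel₀ _ hm0] at h
  linarith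

theorem prod_div_rpow {m : ℕ} (β : Fin m → ℝ) {v : Fin m → ℝ} (hv : ∀ i, 0 < v i) {h : ℝ}
    (hh : 0 < h) :
    ∏ i, (h / v i) ^ (β i + 1) = h ^ ((∑ i, β i) + m) * ∏ i, v i ^ (-(β i) - 1) := by
  have h1 : h ^ ((∑ i, β i) + m) = ∏ i, h ^ (β i + 1) := by
    rw [← Real.rpow_sum_of_pos hh]
    simp [Finset.sum_add_distrib]
  rw [h1, ← Finset.prod_mul_distrib]
  refine Finset.prod_congr rfl fun i _ => ?_
  rw [Real.div_rpow hh.le (hv i).le, show -(β i) - 1 = -(β i + 1) by ring,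
    Real.rpow_neg (hv i).le, div_eq_mul_inv]

/-- **Lemma 3.3**: for `v ∈ S_+^{m−1}` with all `v_i > 0` and
`s ∈ (s_1(v), ‖v‖_1)`, where `s_1(v) = ‖v‖_1 − 2 min_i v_i`, the `β`-content of the
meta-cap satisfies `P_m(C^+(v,s);β) ≍ (‖v‖_1−s)^{β+m} ∏_i v_i^{−β_i−1}`. -/
theorem metaCap_content_near_vertex
    (m : ℕ) (hm : 1 ≤ m) (β : Fin m → ℝ) (hβ : ∀ i, -1 < β i) :
    ∃ c C : ℝ, 0 < c ∧ c ≤ C ∧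
      ∀ (v : EuclideanSpace ℝ (Fin m)) (s : ℝ),
        ‖v‖ = 1 → (∀ i, 0 < v i) →
        (∑ i, v i) - 2 * Finset.univ.inf' ⟨⟨0, hm⟩, Finset.mem_univ _⟩ (fun i => v i) < s →
        s < ∑ i, v i →
        (c * ((∑ i, v i) - s) ^ ((∑ i, β i) + m) * ∏ i, v i ^ (-(β i) - 1)
            ≤ betaContent β (metaCap v s)) ∧
        betaContent β (metaCap v s)
          ≤ C * ((∑ i, v i) - s) ^ ((∑ i, β i) + m) * ∏ i, v i ^ (-(β i) - 1) := by
  choose k K hk hK hkK using fun i => exists_setIntegral_one_sub_sq_rpow_bounds (hβ i)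
  have hm0 : (0 : ℝ) < m := by positivity
  have hb := fun i => betaConst1_pos (hβ i)
  set c := ∏ i, betaConst1 (β i) * (k i * (1 / m : ℝ) ^ (β i + 1)) with hc
  set C := ∏ i, betaConst1 (β i) * K i with hC
  have hc0 : 0 < c := Finset.prod_pos fun i _ =>
    mul_pos (hb i) (mul_pos (hk i) (Real.rpow_pos_of_pos (by positivity) _))
  refine ⟨c, max c C, hc0, le_max_left _ _, fun v s _ hv hs1 hs2 => ?_⟩
  set h := ∑ i, v i - s with hh
  have hh0 : 0 < h := by linarith
  have ha0 : ∀ i, 0 < h / v i := fun i => div_pos hh0 (hv i)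
  have ha2 : ∀ i, h / v i ≤ 2 := fun i => by
    have := Finset.inf'_le (fun i => v i) (Finset.mem_univ i)
    rw [div_le_iff₀ (hv i)]
    linarith
  have hm1 : (1 : ℝ) ≤ m := by exact_mod_cast hm
  have ha2' : ∀ i, h / v i / m ≤ 2 := fun i => (div_le_self (ha0 i).le hm1).trans (ha2 i)
  have hX := prod_div_rpow β hv hh0
  rw [mul_assoc, mul_assoc, ← hX]
  constructor
  · calc c * ∏ i, (h / v i) ^ (β i + 1)
        = ∏ i, betaConst1 (β i) * (k i * (h / v i / m) ^ (β i + 1)) := by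
          rw [hc, ← Finset.prod_mul_distrib]
          refine Finset.prod_congr rfl fun i _ => ?_
          rw [div_eq_mul_one_div (h / v i) (m : ℝ),
            Real.mul_rpow (ha0 i).le (by positivity)]
          ring
      _ ≤ betaContent β (vertexBox fun i => h / v i / m) := by
          rw [betaContent_vertexBox]
          refine Finset.prod_le_prod (fun i _ => mul_nonneg (hb i).le (mul_nonneg (hk i).le
            (Real.rpow_nonneg (div_pos (ha0 i) hm0).le _))) fun i _ => ?_
          exact mul_le_mul_of_nonneg_left (hkK i _ (div_pos (ha0 i) hm0) (ha2' i)).1 (hb i).le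
      _ ≤ _ := betaContent_mono hβ (vertexBox_subset_metaCap hm hv ha2')
          (measurableSet_metaCap v s) fun y hy => hy.1
  · calc betaContent β (metaCap v s)
        ≤ betaContent β (vertexBox fun i => h / v i) :=
          betaContent_mono hβ (metaCap_subset_vertexBox hv s) (measurableSet_vertexBox _)
            fun y hy => abs_le_one_of_mem_vertexBox ha2 hy
      _ ≤ ∏ i, betaConst1 (β i) * (K i * (h / v i) ^ (β i + 1)) := by
          rw [betaContent_vertexBox]
          refine Finset.prod_le_prod (fun i _ => mul_nonneg (hb i).le ?_) fun i _ =>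
            mul_le_mul_of_nonneg_left (hkK i _ (ha0 i) (ha2 i)).2 (hb i).le
          exact (mul_nonneg (hk i).le (Real.rpow_nonneg (ha0 i).le _)).trans
            (hkK i _ (ha0 i) (ha2 i)).1
      _ = C * ∏ i, (h / v i) ^ (β i + 1) := by
          rw [hC, ← Finset.prod_mul_distrib]
          exact Finset.prod_congr rfl fun i _ => by ring
      _ ≤ _ := mul_le_mul_of_nonneg_right (le_max_right _ _)
          (Finset.prod_nonneg fun i _ => Real.rpow_nonneg (ha0 i).le _)
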